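/- Let F be any field, let n1, n2 > 2, and let T ∈ F^{n1} ⊗ F^{n2} ⊗ F^{2} be a concise tensor. Then the subrank of T satisfies Q(T) = 2. -/

import Mathlib

open scoped BigOperators

namespace Paper

variable {F : Type*} [Field F]

/-- Restriction of order-three tensors: `T ≥ S` iff there exist linear maps
(given by matrices `L1, L2, L3`) carrying `T` to `S`. -/
def Restricts {ι1 ι2 ι3 κ1 κ2 κ3 : Type*} [Fintype ι1] [Fintype ι2] [Fintype ι3]
    (T : ι1 → ι2 → ι3 → F) (S : κ1 → κ2 → κ3 → F) : Prop :=
  ∃ (L1 : κ1 → ι1 → F) (L2 : κ2 → ι2 → F) (L3 : κ3 → ι3 → F),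
    ∀ a b c, S a b c = ∑ i, ∑ j, ∑ k, L1 a i * L2 b j * L3 c k * T i j k

/-- The unit (diagonal) tensor `⟨r⟩`. -/
def unitTensor (F : Type*) [Field F] (r : ℕ) : Fin r → Fin r → Fin r → F :=
  fun i j k => if i = j ∧ j = k then 1 else 0

/-- The subrank `Q(T)`: the largest `r` such that `T` restricts to `⟨r⟩`. -/
noncomputable def subrank {ι1 ι2 ι3 : Type*} [Fintype ι1] [Fintype ι2] [Fintype ι3]
    (T : ι1 → ι2 → ι3 → F) : ℕ :=
  sSup {r : ℕ | Restricts T (unitTensor F r)}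

/-- Kronecker (tensor) power `T^{⊠ m}` of an order-three tensor. -/
def kronPow {ι1 ι2 ι3 : Type*} (T : ι1 → ι2 → ι3 → F) (m : ℕ) :
    (Fin m → ι1) → (Fin m → ι2) → (Fin m → ι3) → F :=
  fun x y z => ∏ s : Fin m, T (x s) (y s) (z s)

/-- Asymptotic subrank `Q~(T) = lim_n Q(T^{⊠n})^{1/n} = sup_n Q(T^{⊠n})^{1/n}`. -/
noncomputable def asympSubrank {ι1 ι2 ι3 : Type*} [Fintype ι1] [Fintype ι2] [Fintype ι3]
    (T : ι1 → ι2 → ι3 → F) : ℝ :=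
  ⨆ m : ℕ, (subrank (kronPow T (m + 1)) : ℝ) ^ ((1 : ℝ) / (m + 1))

/-- First flattening of a tensor. -/
def flattening1 {ι1 ι2 ι3 : Type*} (T : ι1 → ι2 → ι3 → F) : Matrix ι1 (ι2 × ι3) F :=
  Matrix.of fun i p => T i p.1 p.2

/-- Second flattening of a tensor. -/
def flattening2 {ι1 ι2 ι3 : Type*} (T : ι1 → ι2 → ι3 → F) : Matrix ι2 (ι1 × ι3) F :=
  Matrix.of fun j p => T p.1 j p.2

/-- Third flattening of a tensor. -/
def flattening3 {ι1 ι2 ι3 : Type*} (T : ι1 → ι2 → ι3 → F) : Matrix ι3 (ι1 × ι2) F :=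
  Matrix.of fun k p => T p.1 p.2 k

/-- A tensor is concise if all three flattening ranks are maximal. -/
noncomputable def Concise {ι1 ι2 ι3 : Type*} [Fintype ι1] [Fintype ι2] [Fintype ι3]
    (T : ι1 → ι2 → ι3 → F) : Prop :=
  (flattening1 T).rank = Fintype.card ι1 ∧
  (flattening2 T).rank = Fintype.card ι2 ∧
  (flattening3 T).rank = Fintype.card ι3

/-- A tensor has slice rank one if one of its flattenings has rank one. -/
noncomputable def SliceRankOne {ι1 ι2 ι3 : Type*} [Fintype ι1] [Fintype ι2] [Fintype ι3]
    (T : ι1 → ι2 → ι3 → F) : Prop :=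
  (flattening1 T).rank = 1 ∨ (flattening2 T).rank = 1 ∨ (flattening3 T).rank = 1

/-- The slice rank `SR(T)`: the least `r` such that `T` is a sum of `r` slice-rank-one
tensors. -/
noncomputable def sliceRank {ι1 ι2 ι3 : Type*} [Fintype ι1] [Fintype ι2] [Fintype ι3]
    (T : ι1 → ι2 → ι3 → F) : ℕ :=
  sInf {r : ℕ | ∃ f : Fin r → (ι1 → ι2 → ι3 → F),
    (∀ t, SliceRankOne (f t)) ∧ T = ∑ t, f t}

/-- The liminf-asymptotic slice rank. -/
noncomputable def asympSliceRankInf {ι1 ι2 ι3 : Type*} [Fintype ι1] [Fintype ι2] [Fintype ι3]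
    (T : ι1 → ι2 → ι3 → F) : ℝ :=
  Filter.liminf (fun m : ℕ => (sliceRank (kronPow T m) : ℝ) ^ ((1 : ℝ) / m)) Filter.atTop

/-- The limsup-asymptotic slice rank. -/
noncomputable def asympSliceRankSup {ι1 ι2 ι3 : Type*} [Fintype ι1] [Fintype ι2] [Fintype ι3]
    (T : ι1 → ι2 → ι3 → F) : ℝ :=
  Filter.limsup (fun m : ℕ => (sliceRank (kronPow T m) : ℝ) ^ ((1 : ℝ) / m)) Filter.atTop

/-- The max-rank of a matrix subspace. -/
noncomputable def maxrank {m n : Type*} [Fintype n] (𝒜 : Submodule F (Matrix m n F)) : ℕ :=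
  sSup {r : ℕ | ∃ A ∈ 𝒜, A.rank = r}

/-- The min-rank of a matrix subspace: the least rank of a nonzero element. -/
noncomputable def minrank {m n : Type*} [Fintype n] (𝒜 : Submodule F (Matrix m n F)) : ℕ :=
  sInf {r : ℕ | ∃ A ∈ 𝒜, A ≠ 0 ∧ A.rank = r}

section Slices

variable {n1 n2 n3 : ℕ}

/-- Span of the 3-slices, rows indexed by direction 1, columns by direction 2. -/
def span12 (T : Fin n1 → Fin n2 → Fin n3 → F) : Submodule F (Matrix (Fin n1) (Fin n2) F) :=
  Submodule.span F (Set.range fun k : Fin n3 => Matrix.of fun i j => T i j k)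

/-- Span of the 3-slices, rows indexed by direction 2, columns by direction 1. -/
def span21 (T : Fin n1 → Fin n2 → Fin n3 → F) : Submodule F (Matrix (Fin n2) (Fin n1) F) :=
  Submodule.span F (Set.range fun k : Fin n3 => Matrix.of fun j i => T i j k)

/-- Span of the 2-slices, rows indexed by direction 1, columns by direction 3. -/
def span13 (T : Fin n1 → Fin n2 → Fin n3 → F) : Submodule F (Matrix (Fin n1) (Fin n3) F) :=
  Submodule.span F (Set.range fun j : Fin n2 => Matrix.of fun i k => T i j k)

/-- Span of the 2-slices, rows indexed by direction 3, columns by direction 1. -/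
def span31 (T : Fin n1 → Fin n2 → Fin n3 → F) : Submodule F (Matrix (Fin n3) (Fin n1) F) :=
  Submodule.span F (Set.range fun j : Fin n2 => Matrix.of fun k i => T i j k)

/-- Span of the 1-slices, rows indexed by direction 2, columns by direction 3. -/
def span23 (T : Fin n1 → Fin n2 → Fin n3 → F) : Submodule F (Matrix (Fin n2) (Fin n3) F) :=
  Submodule.span F (Set.range fun i : Fin n1 => Matrix.of fun j k => T i j k)

/-- Span of the 1-slices, rows indexed by direction 3, columns by direction 2. -/
def span32 (T : Fin n1 → Fin n2 → Fin n3 → F) : Submodule F (Matrix (Fin n3) (Fin n2) F) :=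
  Submodule.span F (Set.range fun i : Fin n1 => Matrix.of fun k j => T i j k)

/-- `Q_1(T)`: max-rank of the span of the 1-slices. -/
noncomputable def Q1 (T : Fin n1 → Fin n2 → Fin n3 → F) : ℕ := maxrank (span23 T)

/-- `Q_2(T)`: max-rank of the span of the 2-slices. -/
noncomputable def Q2 (T : Fin n1 → Fin n2 → Fin n3 → F) : ℕ := maxrank (span13 T)

/-- `Q_3(T)`: max-rank of the span of the 3-slices. -/
noncomputable def Q3 (T : Fin n1 → Fin n2 → Fin n3 → F) : ℕ := maxrank (span12 T)

end Slices

/-- `p` is the pivot of the matrix `A`: the lexicographically least position of a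
nonzero entry. -/
def IsPivot {n1 n2 : ℕ} (A : Matrix (Fin n1) (Fin n2) F) (p : Fin n1 × Fin n2) : Prop :=
  A p.1 p.2 ≠ 0 ∧ ∀ q : Fin n1 × Fin n2, A q.1 q.2 ≠ 0 → p.1 < q.1 ∨ (p.1 = q.1 ∧ p.2 ≤ q.2)

/-- The set of pivots of a matrix subspace (equal to the pivots of any basis with
pairwise distinct pivots). -/
def pivotSet {n1 n2 : ℕ} (𝒜 : Submodule F (Matrix (Fin n1) (Fin n2) F)) :
    Set (Fin n1 × Fin n2) :=
  {p | ∃ A ∈ 𝒜, IsPivot A p}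

/-- `ρ(𝒜)`: the least `r = |S1| + |S2|` such that the pivots of `𝒜` are covered by the
rows `S1` and columns `S2`. -/
noncomputable def rho {n1 n2 : ℕ} (𝒜 : Submodule F (Matrix (Fin n1) (Fin n2) F)) : ℕ :=
  sInf {r : ℕ | ∃ (S1 : Finset (Fin n1)) (S2 : Finset (Fin n2)),
    S1.card + S2.card = r ∧ ∀ p ∈ pivotSet 𝒜, p.1 ∈ S1 ∨ p.2 ∈ S2}

/-- The border subrank `Q̲(T)`: the largest `r` such that, over Laurent polynomials
in `ε`, some restriction of `T` equals `⟨r⟩ + ε S_1 + ⋯ + ε^t S_t`. -/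
noncomputable def borderSubrank {ι1 ι2 ι3 : Type*} [Fintype ι1] [Fintype ι2] [Fintype ι3]
    (T : ι1 → ι2 → ι3 → F) : ℕ :=
  sSup {r : ℕ |
    ∃ (A : Fin r → ι1 → LaurentPolynomial F) (B : Fin r → ι2 → LaurentPolynomial F)
      (C : Fin r → ι3 → LaurentPolynomial F) (t : ℕ)
      (S : Fin t → (Fin r → Fin r → Fin r → F)),
      ∀ a b c,
        (∑ i, ∑ j, ∑ k, A a i * B b j * C c k * LaurentPolynomial.C (T i j k)) =
          LaurentPolynomial.C (unitTensor F r a b c) +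
            ∑ s : Fin t, LaurentPolynomial.T (((s : ℕ) : ℤ) + 1) *
              LaurentPolynomial.C (S s a b c)}

/-- The linear map `A ↦ U * A * V` on rectangular matrices. -/
def conjMap {n1 n2 : ℕ} (U : Matrix (Fin n1) (Fin n1) F) (V : Matrix (Fin n2) (Fin n2) F) :
    Matrix (Fin n1) (Fin n2) F →ₗ[F] Matrix (Fin n1) (Fin n2) F where
  toFun A := U * A * V
  map_add' A B := by simp [Matrix.mul_add, Matrix.add_mul]
  map_smul' c A := by simp [Matrix.mul_smul, Matrix.smul_mul]

/-- The principal submatrix `A_{J×J}`, where `J ⊆ [min{n1,n2}]` is encoded by the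
map `η`. -/
def restrictJJ {n1 n2 jn : ℕ} (η : Fin jn → Fin (min n1 n2))
    (A : Matrix (Fin n1) (Fin n2) F) : Matrix (Fin jn) (Fin jn) F :=
  Matrix.of fun p q =>
    A (Fin.castLE (min_le_left n1 n2) (η p)) (Fin.castLE (min_le_right n1 n2) (η q))

/-- An order-three tensor over `F` of arbitrary format. -/
structure Tensor3 (F : Type*) [Field F] where
  n1 : ℕ
  n2 : ℕ
  n3 : ℕ
  coef : Fin n1 → Fin n2 → Fin n3 → F

/-- Two tensors are equivalent if each restricts to the other. -/
def Tensor3.Equivalent (T S : Tensor3 F) : Prop :=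
  Restricts T.coef S.coef ∧ Restricts S.coef T.coef

/-- A rank-one order-`k` tensor: a tensor product of `k` nonzero vectors. -/
def RankOne {k : ℕ} {ι : Fin k → Type*} (T : ((i : Fin k) → ι i) → F) : Prop :=
  ∃ u : (i : Fin k) → (ι i → F), (∀ i, u i ≠ 0) ∧ ∀ v, T v = ∏ i, u i (v i)

/-- The tensor rank of an order-`k` tensor. -/
noncomputable def tensorRank {k : ℕ} {ι : Fin k → Type*} (T : ((i : Fin k) → ι i) → F) : ℕ :=
  sInf {r : ℕ | ∃ f : Fin r → (((i : Fin k) → ι i) → F),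
    (∀ t, RankOne (f t)) ∧ T = ∑ t, f t}

/-- Kronecker power of an order-`k` tensor. -/
def kronPowK {k : ℕ} {ι : Fin k → Type*} (T : ((i : Fin k) → ι i) → F) (m : ℕ) :
    ((i : Fin k) → (Fin m → ι i)) → F :=
  fun v => ∏ s : Fin m, T fun i => v i s

/-- The asymptotic rank `R~(T) = lim_n R(T^{⊠n})^{1/n} = inf_n R(T^{⊠n})^{1/n}`. -/
noncomputable def asympRank {k : ℕ} {ι : Fin k → Type*} (T : ((i : Fin k) → ι i) → F) : ℝ :=
  ⨅ m : ℕ, (tensorRank (kronPowK T (m + 1)) : ℝ) ^ ((1 : ℝ) / (m + 1))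

/-- A bilinear map into the plane, non-degenerate on both sides, whose domains have dimension
at least three and whose values span the plane, contains a diagonal `2 × 2` subsystem. -/
theorem exists_diagonal_pair {U V : Type*} [AddCommGroup U] [Module F U]
    [AddCommGroup V] [Module F V] [FiniteDimensional F U] [FiniteDimensional F V]
    (f : U →ₗ[F] V →ₗ[F] (Fin 2 → F))
    (hU : 2 < Module.finrank F U) (hV : 2 < Module.finrank F V)
    (hl : ∀ u, (∀ v, f u v = 0) → u = 0) (hr : ∀ v, (∀ u, f u v = 0) → v = 0)
    (hs : ∃ u v u' v', f u v 0 * f u' v' 1 - f u v 1 * f u' v' 0 ≠ 0) :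
    ∃ u u' v v', f u v' = 0 ∧ f u' v = 0 ∧ f u v 0 * f u' v' 1 - f u v 1 * f u' v' 0 ≠ 0 := by
  by_contra! hne
  have key : ∀ u v, f u v = 0 → ∀ x y,
      f u y 0 * f x v 1 - f u y 1 * f x v 0 = 0 := by
    intro u v huv x y
    by_contra hD
    set D := f u y 0 * f x v 1 - f u y 1 * f x v 0 with hDdef
    obtain ⟨α, hα⟩ : ∃ α, α = -(f x y 0 * f x v 1 - f x y 1 * f x v 0) / D := ⟨_, rfl⟩
    obtain ⟨β, hβ⟩ : ∃ β, β = -(f u y 0 * f x y 1 - f u y 1 * f x y 0) / D := ⟨_, rfl⟩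
    have hα' : α * D = -(f x y 0 * f x v 1 - f x y 1 * f x v 0) := by
      rw [hα]; field_simp
    have hβ' : β * D = -(f u y 0 * f x y 1 - f u y 1 * f x y 0) := by
      rw [hβ]; field_simp
    have h0 : f (x + α • u) (y + β • v) = 0 := by
      ext k
      apply mul_right_cancel₀ hD
      simp only [map_add, map_smul, LinearMap.add_apply, LinearMap.smul_apply, huv,
        Pi.add_apply, Pi.smul_apply, smul_eq_mul, Pi.zero_apply, zero_mul, mul_zero, add_zero]
      fin_cases k
      · simp only [Fin.zero_eta]
        linear_combination (f u y 0) * hα' + (f x v 0) * hβ' + f x y 0 * hDdef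
      · simp only [Fin.mk_one]
        linear_combination (f u y 1) * hα' + (f x v 1) * hβ' + f x y 1 * hDdef
    apply hD
    rw [hDdef]
    simpa [huv] using hne u (x + α • u) (y + β • v) v huv h0
  have hcol : ∀ u y y', f u y 0 * f u y' 1 - f u y 1 * f u y' 0 = 0 := by
    intro u y y'
    obtain ⟨v, hv, hv0⟩ := (Submodule.ne_bot_iff _).1 (LinearMap.ker_ne_bot_of_finrank_lt
      (f := f u) (by simpa using hV))
    obtain ⟨x, hx⟩ : ∃ x, f x v ≠ 0 := by
      by_contra! h
      exact hv0 (hr v h)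
    have e1 := key u v hv x y
    have e2 := key u v hv x y'
    obtain ⟨k, hk⟩ := Function.ne_iff.1 hx
    fin_cases k
    · apply (mul_eq_zero.1 _).resolve_left hk
      simp only [Fin.zero_eta]
      linear_combination (f u y' 0) * e1 - f u y 0 * e2
    · apply (mul_eq_zero.1 _).resolve_left hk
      simp only [Fin.mk_one]
      linear_combination (f u y' 1) * e1 - f u y 1 * e2
  have hrow : ∀ v x x', f x v 0 * f x' v 1 - f x v 1 * f x' v 0 = 0 := by
    intro v x x'
    obtain ⟨u, hu, hu0⟩ := (Submodule.ne_bot_iff _).1 (LinearMap.ker_ne_bot_of_finrank_lt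
      (f := f.flip v) (by simpa using hU))
    obtain ⟨y, hy⟩ : ∃ y, f u y ≠ 0 := by
      by_contra! h
      exact hu0 (hl u h)
    have e1 := key u v hu x y
    have e2 := key u v hu x' y
    obtain ⟨k, hk⟩ := Function.ne_iff.1 hy
    fin_cases k
    · apply (mul_eq_zero.1 _).resolve_left hk
      simp only [Fin.zero_eta]
      linear_combination (-f x' v 0) * e1 + f x v 0 * e2
    · apply (mul_eq_zero.1 _).resolve_left hk
      simp only [Fin.mk_one]
      linear_combination (-f x' v 1) * e1 + f x v 1 * e2
  have hzero : ∀ a b c : Fin 2 → F, a 0 * b 1 - a 1 * b 0 ≠ 0 → a 0 * c 1 - a 1 * c 0 = 0 →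
      b 0 * c 1 - b 1 * c 0 = 0 → c = 0 := by
    intro a b c h ha hb
    ext k
    apply (mul_eq_zero.1 _).resolve_left h
    fin_cases k
    · simp only [Fin.zero_eta]
      linear_combination b 0 * ha - a 0 * hb
    · simp only [Fin.mk_one]
      linear_combination b 1 * ha - a 1 * hb
  obtain ⟨u, v, u', v', h⟩ := hs
  have huv := hzero _ _ _ h (hcol u v v') (hrow v' u' u)
  have hvu := hzero _ _ _ h (hrow v u u') (hcol u' v' v)
  exact h (hne _ _ _ _ huv hvu)

/-- A matrix of full row rank has trivial left kernel. -/
theorem eq_zero_of_rank_eq_card {m n : Type*} [Fintype m] [Fintype n] (A : Matrix m n F)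
    (hA : A.rank = Fintype.card m) (w : m → F) (hw : ∀ j, ∑ i, w i * A i j = 0) : w = 0 := by
  have hli : LinearIndependent F A.row := by
    rw [linearIndependent_iff_card_eq_finrank_span, ← hA, A.rank_eq_finrank_span_row]
    rfl
  funext i
  refine Fintype.linearIndependent_iff.1 hli w ?_ i
  ext j
  simpa [Finset.sum_apply] using hw j

/-- The contraction of a tensor along its first two legs, as a bilinear map. -/
def contraction {ι1 ι2 ι3 : Type*} [Fintype ι1] [Fintype ι2] (T : ι1 → ι2 → ι3 → F) :
    (ι1 → F) →ₗ[F] (ι2 → F) →ₗ[F] (ι3 → F) :=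
  LinearMap.mk₂ F (fun u v k => ∑ i, ∑ j, u i * v j * T i j k)
    (fun u u' v => by ext k; simp [add_mul, Finset.sum_add_distrib])
    (fun c u v => by ext k; simp [Finset.mul_sum, mul_assoc])
    (fun u v v' => by ext k; simp [add_mul, mul_add, Finset.sum_add_distrib])
    (fun c u v => by ext k; simp [Finset.mul_sum, mul_assoc, mul_left_comm])

theorem contraction_apply {ι1 ι2 ι3 : Type*} [Fintype ι1] [Fintype ι2] (T : ι1 → ι2 → ι3 → F)
    (u : ι1 → F) (v : ι2 → F) (k : ι3) :
    contraction T u v k = ∑ i, ∑ j, u i * v j * T i j k := rfl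

theorem sum_eq_sum_contraction {ι1 ι2 ι3 : Type*} [Fintype ι1] [Fintype ι2] [Fintype ι3]
    (T : ι1 → ι2 → ι3 → F) (u : ι1 → F) (v : ι2 → F) (w : ι3 → F) :
    ∑ i, ∑ j, ∑ k, u i * v j * w k * T i j k = ∑ k, w k * contraction T u v k := by
  simp only [contraction_apply, Finset.mul_sum]
  conv_rhs => rw [Finset.sum_comm]
  refine Finset.sum_congr rfl fun i _ => ?_
  conv_rhs => rw [Finset.sum_comm]
  exact Finset.sum_congr rfl fun j _ => Finset.sum_congr rfl fun k _ => by ring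

/-- A unit tensor obtained by restriction is no larger than the third leg. -/
theorem Restricts.le_card {ι1 ι2 ι3 : Type*} [Fintype ι1] [Fintype ι2] [Fintype ι3]
    {T : ι1 → ι2 → ι3 → F} {r : ℕ} (h : Restricts T (unitTensor F r)) :
    r ≤ Fintype.card ι3 := by
  obtain ⟨L1, L2, L3, h⟩ := h
  have hmul : (Matrix.of L3) *
      (Matrix.of fun k a => contraction T (L1 a) (L2 a) k) = (1 : Matrix (Fin r) (Fin r) F) := by
    ext c a
    have := h a a c
    rw [sum_eq_sum_contraction] at this
    simp only [Matrix.mul_apply, Matrix.of_apply, ← this, unitTensor, Matrix.one_apply, true_and,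
      eq_comm]
  have h1 := Matrix.rank_mul_le_left (Matrix.of L3)
    (Matrix.of fun k a => contraction T (L1 a) (L2 a) k)
  rw [hmul, Matrix.rank_one, Fintype.card_fin] at h1
  exact h1.trans (Matrix.rank_le_card_width _)

/-- A diagonal `2 × 2` subsystem of the contraction yields a restriction to `⟨2⟩`. -/
theorem restricts_unitTensor_two {ι1 ι2 : Type*} [Fintype ι1] [Fintype ι2]
    {T : ι1 → ι2 → Fin 2 → F} {u u' : ι1 → F} {v v' : ι2 → F}
    (h : contraction T u v' = 0) (h' : contraction T u' v = 0)
    (hD : contraction T u v 0 * contraction T u' v' 1 -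
      contraction T u v 1 * contraction T u' v' 0 ≠ 0) :
    Restricts T (unitTensor F 2) := by
  set a := contraction T u v with ha
  set b := contraction T u' v' with hb
  obtain ⟨D, hDab⟩ : ∃ D, D = a 0 * b 1 - a 1 * b 0 := ⟨_, rfl⟩
  rw [← hDab] at hD
  refine ⟨![u, u'], ![v, v'], ![![b 1 / D, -b 0 / D], ![-a 1 / D, a 0 / D]],
    fun i j k => ?_⟩
  rw [sum_eq_sum_contraction]
  fin_cases i <;> fin_cases j <;> fin_cases k <;>
    simp [unitTensor, h, h', ← ha, ← hb] <;> field_simp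
  · linear_combination hDab
  · ring
  · ring
  · linear_combination hDab

/-- For `n1, n2 > 2`, every concise tensor of format `(n1, n2, 2)`
has subrank exactly `2`. -/
theorem subrank_eq_two (F : Type*) [Field F] (n1 n2 : ℕ) (h1 : 2 < n1) (h2 : 2 < n2)
    (T : Fin n1 → Fin n2 → Fin 2 → F) (hT : Concise T) :
    subrank T = 2 := by
  obtain ⟨hT1, hT2, hT3⟩ := hT
  refine IsGreatest.csSup_eq ⟨?_, fun r hr => by simpa using Restricts.le_card hr⟩
  have hsingle : ∀ i j, contraction T (Pi.single i 1) (Pi.single j 1) = T i j := by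
    intro i j
    ext k
    simp [contraction_apply, Pi.single_apply]
  have hl : ∀ u, (∀ v, contraction T u v = 0) → u = 0 := by
    refine fun u hu => eq_zero_of_rank_eq_card _ hT1 u fun p => ?_
    simpa [contraction_apply, Pi.single_apply, flattening1]
      using congrFun (hu (Pi.single p.1 1)) p.2
  have hr : ∀ v, (∀ u, contraction T u v = 0) → v = 0 := by
    refine fun v hv => eq_zero_of_rank_eq_card _ hT2 v fun p => ?_
    simpa [contraction_apply, Pi.single_apply, flattening2]
      using congrFun (hv (Pi.single p.1 1)) p.2
  have hs : ∃ u v u' v', contraction T u v 0 * contraction T u' v' 1 -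
      contraction T u v 1 * contraction T u' v' 0 ≠ 0 := by
    by_contra! hw
    have hT0 : ∀ i j, ![-T i j 1, T i j 0] = 0 := by
      refine fun i j => eq_zero_of_rank_eq_card _ hT3 _ fun p => ?_
      have := hw (Pi.single i 1) (Pi.single j 1) (Pi.single p.1 1) (Pi.single p.2 1)
      rw [hsingle, hsingle] at this
      simp only [flattening3, Fin.sum_univ_two, Matrix.of_apply, Matrix.cons_val_zero,
        Matrix.cons_val_one]
      linear_combination this
    have := eq_zero_of_rank_eq_card _ hT3 ![1, 0] fun p => by
      simpa [flattening3] using congrFun (hT0 p.1 p.2) 1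
    simpa using congrFun this 0
  obtain ⟨u, u', v, v', h, h', hD⟩ := exists_diagonal_pair (contraction T) (by simpa) (by simpa)
    hl hr hs
  exact restricts_unitTensor_two h h' hD

end Paper
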